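/- Let a > 0 and let V : ℝ → ℝ be real-analytic and a-periodic. For λ ∈ ℝ let E(λ) denote the real vector space of C^∞ functions f : ℝ² → ℝ that are a-periodic in x and 2π-periodic in y and satisfy −∂²f/∂x² − ∂²f/∂y² − V(x)·f = λ·f, and for μ ∈ ℝ let E₀(μ) denote the real vector space of C^∞ a-periodic functions u : ℝ → ℝ satisfying −u'' − V·u = μ·u. Then for every λ ∈ ℝ: (i) E₀(λ − n²) = {0} for all sufficiently large positive integers n, and (ii) dim E(λ) = dim E₀(λ) + 2·Σ_{n ≥ 1} dim E₀(λ − n²), where the sum on the right has only finitely many nonzero terms. -/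

import Mathlib

/-- The set of smooth solutions of `-u'' - V u = μ u` that are `a`-periodic; this set is a
linear subspace of `ℝ → ℝ`, so it coincides with its span `E₀(μ)`. -/
def solSet0 (a : ℝ) (V : ℝ → ℝ) (μ : ℝ) : Set (ℝ → ℝ) :=
  {u : ℝ → ℝ | ContDiff ℝ (⊤ : ℕ∞) u ∧ (∀ x : ℝ, u (x + a) = u x) ∧
    ∀ x : ℝ, -(deriv (deriv u) x) - V x * u x = μ * u x}

/-- `dim E₀(μ)`, the dimension of the space of `a`-periodic solutions of `-u'' - V u = μ u`. -/
noncomputable def dimE0 (a : ℝ) (V : ℝ → ℝ) (μ : ℝ) : ℕ :=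
  Module.finrank ℝ ↥(Submodule.span ℝ (solSet0 a V μ))

/-- The set of smooth functions on `ℝ²`, `a`-periodic in `x` and `2π`-periodic in `y`,
satisfying `-∂²f/∂x² - ∂²f/∂y² - V(x) f = lam f`; this set is a linear subspace of
`ℝ × ℝ → ℝ`, so it coincides with its span `E(lam)`. -/
def solSet (a : ℝ) (V : ℝ → ℝ) (lam : ℝ) : Set (ℝ × ℝ → ℝ) :=
  {f : ℝ × ℝ → ℝ | ContDiff ℝ (⊤ : ℕ∞) f ∧ (∀ x y : ℝ, f (x + a, y) = f (x, y)) ∧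
    (∀ x y : ℝ, f (x, y + 2 * Real.pi) = f (x, y)) ∧
    ∀ x y : ℝ, -(deriv (deriv fun s : ℝ => f (s, y)) x)
      - (deriv (deriv fun t : ℝ => f (x, t)) y) - V x * f (x, y) = lam * f (x, y)}

/-- `dim E(lam)`, the dimension of the `lam`-eigenspace of the torus operator. -/
noncomputable def dimE (a : ℝ) (V : ℝ → ℝ) (lam : ℝ) : ℕ :=
  Module.finrank ℝ ↥(Submodule.span ℝ (solSet a V lam))

open Real MeasureTheory

section Parametric

/-- Differentiation under the integral sign for `C¹` integrands on a compact interval. -/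
theorem hasDerivAt_intervalIntegral_of_contDiff {F : ℝ × ℝ → ℝ} (hF : ContDiff ℝ 1 F)
    (b c x₀ : ℝ) :
    HasDerivAt (fun x => ∫ y in b..c, F (x, y)) (∫ y in b..c, fderiv ℝ F (x₀, y) (1, 0)) x₀ := by
  have hcont : Continuous fun p : ℝ × ℝ => fderiv ℝ F p (1, 0) :=
    (hF.continuous_fderiv one_ne_zero).clm_apply continuous_const
  have hK : IsCompact (Metric.closedBall x₀ 1 ×ˢ Set.uIcc b c) :=
    (isCompact_closedBall x₀ 1).prod isCompact_uIcc
  obtain ⟨C, hC⟩ := hK.exists_bound_of_continuousOn hcont.continuousOn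
  have hcx : ∀ x, Continuous fun y : ℝ => F (x, y) := fun x =>
    hF.continuous.comp (by fun_prop)
  refine (intervalIntegral.hasDerivAt_integral_of_dominated_loc_of_deriv_le (μ := volume)
    (F := fun x y => F (x, y)) (F' := fun x y => fderiv ℝ F (x, y) (1, 0)) (bound := fun _ => C)
    (Metric.ball_mem_nhds x₀ one_pos)
    (Filter.Eventually.of_forall fun x => (hcx x).aestronglyMeasurable)
    ((hcx x₀).intervalIntegrable _ _) ?_ ?_ intervalIntegrable_const ?_).2
  · exact (hcont.comp (by fun_prop : Continuous fun y : ℝ => (x₀, y))).aestronglyMeasurable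
  · exact Filter.Eventually.of_forall fun y hy x hx =>
      hC (x, y) ⟨Metric.ball_subset_closedBall hx, Set.uIoc_subset_uIcc hy⟩
  · refine Filter.Eventually.of_forall fun y _ x _ => ?_
    have h1 : HasFDerivAt F (fderiv ℝ F (x, y)) (x, y) :=
      (hF.differentiable one_ne_zero).differentiableAt.hasFDerivAt
    exact h1.comp_hasDerivAt x ((hasDerivAt_id x).prodMk (hasDerivAt_const x y))

theorem contDiff_fderiv_apply_const {F : ℝ × ℝ → ℝ} (hF : ContDiff ℝ (⊤ : ℕ∞) F) (v : ℝ × ℝ) :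
    ContDiff ℝ (⊤ : ℕ∞) fun p => fderiv ℝ F p v :=
  (hF.fderiv_right (m := ((⊤ : ℕ∞) : WithTop ℕ∞)) (by simp)).clm_apply contDiff_const

theorem contDiff_intervalIntegral {F : ℝ × ℝ → ℝ} (hF : ContDiff ℝ (⊤ : ℕ∞) F) (b c : ℝ) :
    ContDiff ℝ (⊤ : ℕ∞) fun x => ∫ y in b..c, F (x, y) := by
  refine contDiff_infty.2 fun n => ?_
  induction n generalizing F with
  | zero =>
    refine contDiff_zero.2 (continuous_iff_continuousAt.2 fun x => ?_)
    exact (hasDerivAt_intervalIntegral_of_contDiff (hF.of_le (by simp)) b c x).continuousAt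
  | succ n ih =>
    have hd := hasDerivAt_intervalIntegral_of_contDiff (hF.of_le (by simp)) b c
    push_cast
    refine contDiff_succ_iff_deriv.2 ⟨fun x => (hd x).differentiableAt, by simp, ?_⟩
    rw [funext fun x => (hd x).deriv]
    exact ih (contDiff_fderiv_apply_const hF _)

end Parametric

section Cas

/-- The function `cas (k y) = cos (k y) + sin (k y)`; for `k : ℤ` these form an orthogonal
system on a period, complete among continuous `2π`-periodic functions. -/
noncomputable def cas (k : ℤ) (y : ℝ) : ℝ := cos (k * y) + sin (k * y)

theorem contDiff_cas (k : ℤ) : ContDiff ℝ (⊤ : ℕ∞) (cas k) := by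
  unfold cas; fun_prop

theorem cas_periodic (k : ℤ) (y : ℝ) : cas k (y + 2 * π) = cas k y := by
  simp only [cas, mul_add]
  rw [cos_add_int_mul_two_pi, sin_add_int_mul_two_pi]

theorem hasDerivAt_cas (k : ℤ) (y : ℝ) : HasDerivAt (cas k) (k * cas (-k) y) y := by
  have h : HasDerivAt (fun y : ℝ => (k : ℝ) * y) k y := by
    simpa using (hasDerivAt_id y).const_mul (k : ℝ)
  convert! h.cos.add h.sin using 1
  simp only [cas, Int.cast_neg, neg_mul, cos_neg, sin_neg]; ring

theorem deriv_cas (k : ℤ) : deriv (cas k) = fun y => k * cas (-k) y :=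
  funext fun y => (hasDerivAt_cas k y).deriv

theorem deriv_deriv_cas (k : ℤ) (y : ℝ) : deriv (deriv (cas k)) y = -(k : ℝ) ^ 2 * cas k y := by
  rw [deriv_cas, ((hasDerivAt_cas (-k) y).const_mul (k : ℝ)).deriv, neg_neg]
  push_cast; ring

theorem integral_cos_int_mul {k : ℤ} (hk : k ≠ 0) : ∫ y in (0 : ℝ)..2 * π, cos (k * y) = 0 := by
  have : (k : ℝ) ≠ 0 := by exact_mod_cast hk
  rw [intervalIntegral.integral_comp_mul_left (fun y => cos y) this, integral_cos]
  have := sin_add_int_mul_two_pi 0 k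
  simp_all

theorem integral_sin_int_mul (k : ℤ) : ∫ y in (0 : ℝ)..2 * π, sin (k * y) = 0 := by
  rcases eq_or_ne k 0 with rfl | hk
  · simp
  have : (k : ℝ) ≠ 0 := by exact_mod_cast hk
  rw [intervalIntegral.integral_comp_mul_left (fun y => sin y) this, integral_sin]
  have := cos_add_int_mul_two_pi 0 k
  simp_all

theorem integral_cas_mul_cas (k l : ℤ) :
    ∫ y in (0 : ℝ)..2 * π, cas k y * cas l y = if k = l then 2 * π else 0 := by
  have h : ∀ y, cas k y * cas l y =
      cos ((k - l : ℤ) * y) + sin ((k + l : ℤ) * y) := fun y => by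
    push_cast
    rw [sub_mul, add_mul, cos_sub, sin_add]; unfold cas; ring
  simp_rw [h]
  rw [intervalIntegral.integral_add
    (Continuous.intervalIntegrable (by fun_prop) _ _)
    (Continuous.intervalIntegrable (by fun_prop) _ _), integral_sin_int_mul, add_zero]
  split_ifs with hkl
  · simp [hkl]
  · exact integral_cos_int_mul (sub_ne_zero.2 hkl)

/-- A continuous `2π`-periodic function orthogonal to every `cas k` vanishes. -/
theorem eq_zero_of_integral_mul_cas_eq_zero {g : ℝ → ℝ} (hg : Continuous g)
    (hper : ∀ y, g (y + 2 * π) = g y)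
    (h : ∀ k : ℤ, ∫ y in (0 : ℝ)..2 * π, g y * cas k y = 0) (y : ℝ) : g y = 0 := by
  have : Fact (0 < 2 * π) := ⟨two_pi_pos⟩
  have hper' : Function.Periodic (fun y => (g y : ℂ)) (2 * π) := fun y => by simp [hper y]
  let G : C(AddCircle (2 * π), ℂ) :=
    ⟨hper'.lift, continuous_quot_lift _ (Complex.continuous_ofReal.comp hg)⟩
  have hG : ∀ y : ℝ, G (y : AddCircle (2 * π)) = g y := fun y => rfl
  have hci : ∀ (k : ℤ), IntervalIntegrable (fun y => g y * cos (k * y)) volume 0 (2 * π) :=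
    fun k => Continuous.intervalIntegrable (by fun_prop) _ _
  have hsi : ∀ (k : ℤ), IntervalIntegrable (fun y => g y * sin (k * y)) volume 0 (2 * π) :=
    fun k => Continuous.intervalIntegrable (by fun_prop) _ _
  have hcs : ∀ k : ℤ, (∫ y in (0 : ℝ)..2 * π, g y * cos (k * y)) = 0 ∧
      (∫ y in (0 : ℝ)..2 * π, g y * sin (k * y)) = 0 := fun k => by
    have h1 := h k
    have h2 := h (-k)
    simp only [cas, Int.cast_neg, neg_mul, cos_neg, sin_neg, ← sub_eq_add_neg, mul_add, mul_sub] at h1 h2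
    rw [intervalIntegral.integral_add (hci k) (hsi k)] at h1
    rw [intervalIntegral.integral_sub (hci k) (hsi k)] at h2
    constructor <;> linarith
  have hcoef : fourierCoeff G = 0 := by
    funext k
    rw [fourierCoeff_eq_intervalIntegral _ _ 0, zero_add]
    have hpt : ∀ y : ℝ, (fourier (-k) (y : AddCircle (2 * π)) : ℂ) • G y =
        ((g y * cos (k * y) : ℝ) : ℂ) - ((g y * sin (k * y) : ℝ) : ℂ) * Complex.I := fun y => by
      have hexp : (fourier (-k) (y : AddCircle (2 * π)) : ℂ) =
          Complex.cos (k * y) - Complex.sin (k * y) * Complex.I := by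
        rw [fourier_coe_apply, show (2 * π * Complex.I * (-k : ℤ) * y / (2 * π : ℝ) : ℂ) =
          (-(k * y)) * Complex.I by
            have : (π : ℂ) ≠ 0 := by exact_mod_cast pi_ne_zero
            push_cast; field_simp, Complex.exp_mul_I, Complex.cos_neg, Complex.sin_neg]
        ring
      rw [hexp, hG, smul_eq_mul]; push_cast; ring
    simp_rw [hpt]
    rw [intervalIntegral.integral_sub (Continuous.intervalIntegrable (by fun_prop) _ _)
      (Continuous.intervalIntegrable (by fun_prop) _ _), intervalIntegral.integral_mul_const, intervalIntegral.integral_ofReal,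
      intervalIntegral.integral_ofReal, (hcs k).1, (hcs k).2]
    simp
  have hs := has_pointwise_sum_fourier_series_of_summable (f := G)
    (by rw [hcoef]; exact summable_zero) (y : AddCircle (2 * π))
  rw [hcoef] at hs
  simp only [Pi.zero_apply, zero_smul] at hs
  have := hs.unique hasSum_zero
  rw [hG] at this
  exact_mod_cast this

end Cas

section Spaces

theorem differentiable_deriv_of_smooth {u : ℝ → ℝ} (hu : ContDiff ℝ (⊤ : ℕ∞) u) :
    Differentiable ℝ (deriv u) :=
  (contDiff_infty_iff_deriv.1 hu).2.differentiable (by simp)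

theorem deriv_deriv_add {u v : ℝ → ℝ} (hu : ContDiff ℝ (⊤ : ℕ∞) u) (hv : ContDiff ℝ (⊤ : ℕ∞) v)
    (x : ℝ) :
    deriv (deriv fun s => u s + v s) x = deriv (deriv u) x + deriv (deriv v) x := by
  have h : (deriv fun s => u s + v s) = fun s => deriv u s + deriv v s := funext fun s =>
    deriv_fun_add (hu.differentiable (by simp) s) (hv.differentiable (by simp) s)
  rw [h, deriv_fun_add (differentiable_deriv_of_smooth hu x) (differentiable_deriv_of_smooth hv x)]

theorem deriv_deriv_const_mul (c : ℝ) (u : ℝ → ℝ) (x : ℝ) :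
    deriv (deriv fun s => c * u s) x = c * deriv (deriv u) x := by
  have h : (deriv fun s => c * u s) = fun s => c * deriv u s := funext fun s => by
    simp
  rw [h]; simp

variable (a : ℝ) (V : ℝ → ℝ) (μ : ℝ)

/-- `solSet0` as a submodule. -/
def solSubmodule0 : Submodule ℝ (ℝ → ℝ) where
  carrier := solSet0 a V μ
  zero_mem' := ⟨contDiff_const, by simp, by simp⟩
  add_mem' := by
    rintro u v ⟨hu, hup, hue⟩ ⟨hv, hvp, hve⟩
    refine ⟨hu.add hv, fun x => by simp [hup, hvp], fun x => ?_⟩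
    have := deriv_deriv_add hu hv x
    change -(deriv (deriv fun s => u s + v s) x) - V x * (u x + v x) = μ * (u x + v x)
    linear_combination hue x + hve x - this
  smul_mem' := by
    rintro c u ⟨hu, hup, hue⟩
    refine ⟨contDiff_const.smul hu, fun x => by simp [hup], fun x => ?_⟩
    have := deriv_deriv_const_mul c u x
    change -(deriv (deriv fun s => c * u s) x) - V x * (c * u x) = μ * (c * u x)
    linear_combination c * hue x - this

theorem contDiff_slice_left {f : ℝ × ℝ → ℝ} (hf : ContDiff ℝ (⊤ : ℕ∞) f) (y : ℝ) :
    ContDiff ℝ (⊤ : ℕ∞) fun s => f (s, y) :=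
  hf.comp (contDiff_id.prodMk contDiff_const)

theorem contDiff_slice_right {f : ℝ × ℝ → ℝ} (hf : ContDiff ℝ (⊤ : ℕ∞) f) (x : ℝ) :
    ContDiff ℝ (⊤ : ℕ∞) fun t => f (x, t) :=
  hf.comp (contDiff_const.prodMk contDiff_id)

/-- `solSet` as a submodule. -/
def solSubmodule : Submodule ℝ (ℝ × ℝ → ℝ) where
  carrier := solSet a V μ
  zero_mem' := ⟨contDiff_const, by simp, by simp, by simp⟩
  add_mem' := by
    rintro u v ⟨hu, hup, huq, hue⟩ ⟨hv, hvp, hvq, hve⟩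
    refine ⟨hu.add hv, fun x y => by simp [hup, hvp], fun x y => by simp [huq, hvq],
      fun x y => ?_⟩
    have h1 := deriv_deriv_add (contDiff_slice_left hu y) (contDiff_slice_left hv y) x
    have h2 := deriv_deriv_add (contDiff_slice_right hu x) (contDiff_slice_right hv x) y
    change -(deriv (deriv fun s => u (s, y) + v (s, y)) x)
      - (deriv (deriv fun t => u (x, t) + v (x, t)) y) - V x * (u (x, y) + v (x, y))
      = μ * (u (x, y) + v (x, y))
    linear_combination hue x y + hve x y - h1 - h2
  smul_mem' := by
    rintro c u ⟨hu, hup, huq, hue⟩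
    refine ⟨contDiff_const.smul hu, fun x y => by simp [hup], fun x y => by simp [huq],
      fun x y => ?_⟩
    have h1 := deriv_deriv_const_mul c (fun s => u (s, y)) x
    have h2 := deriv_deriv_const_mul c (fun t => u (x, t)) y
    change -(deriv (deriv fun s => c * u (s, y)) x)
      - (deriv (deriv fun t => c * u (x, t)) y) - V x * (c * u (x, y)) = μ * (c * u (x, y))
    linear_combination c * hue x y - h1 - h2

theorem dimE0_eq : dimE0 a V μ = Module.finrank ℝ (solSubmodule0 a V μ) := by
  unfold dimE0
  rw [show solSet0 a V μ = (solSubmodule0 a V μ : Set (ℝ → ℝ)) from rfl, Submodule.span_eq]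

theorem dimE_eq : dimE a V μ = Module.finrank ℝ (solSubmodule a V μ) := by
  unfold dimE
  rw [show solSet a V μ = (solSubmodule a V μ : Set (ℝ × ℝ → ℝ)) from rfl, Submodule.span_eq]

end Spaces

section ODE

variable {a : ℝ} {V : ℝ → ℝ} {μ : ℝ}

theorem exists_abs_le_of_periodic (ha : 0 < a) (hV : Continuous V)
    (hVper : ∀ x, V (x + a) = V x) : ∃ M, ∀ x, |V x| ≤ M := by
  obtain ⟨M, hM⟩ := (Function.Periodic.isBounded_of_continuous (f := V) hVper ha.ne'
    hV).exists_norm_le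
  exact ⟨M, fun x => hM _ ⟨x, rfl⟩⟩

/-- A periodic solution of `-u'' - V u = μ u` vanishes when `V + μ < 0`. -/
theorem eq_zero_of_add_neg (ha : 0 < a) (h : ∀ x, V x + μ < 0) {u : ℝ → ℝ}
    (hu : u ∈ solSet0 a V μ) : u = 0 := by
  obtain ⟨hs, hp, he⟩ := hu
  have hd : ∀ x, HasDerivAt (fun x => u x * deriv u x)
      (deriv u x * deriv u x + u x * deriv (deriv u) x) x := fun x =>
    (hs.differentiable (by simp) x).hasDerivAt.mul
      (differentiable_deriv_of_smooth hs x).hasDerivAt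
  have hval : ∀ x, deriv u x * deriv u x + u x * deriv (deriv u) x =
      deriv u x ^ 2 + -(V x + μ) * u x ^ 2 := fun x => by linear_combination (-u x) * he x
  have hmono : Monotone fun x => u x * deriv u x := by
    refine monotone_of_deriv_nonneg (fun x => (hd x).differentiableAt) fun x => ?_
    rw [(hd x).deriv, hval]
    have := h x
    have : 0 ≤ -(V x + μ) := by linarith
    positivity
  have hper : Function.Periodic (fun x => u x * deriv u x) a := fun x => by
    have : deriv u (x + a) = deriv u x := by
      rw [← deriv_comp_add_const]; simp only [hp]
    simp only [hp, this]
  have hconst : ∀ x, u x * deriv u x = u 0 * deriv u 0 := fun x => by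
    obtain ⟨n, hn⟩ := exists_nat_gt (|x| / a)
    have hna : |x| < n * a := by rwa [div_lt_iff₀ ha] at hn
    have h1 := hmono (show x ≤ n * a by linarith [le_abs_self x])
    have h2 := hmono (show -(n * a) ≤ x by linarith [neg_abs_le x])
    have e1 := (hper.nat_mul n).eq
    have e2 := (hper.nat_mul n).neg 0
    simp only [zero_add] at e1 e2
    exact le_antisymm (h1.trans_eq e1) (e2.symm.trans_le h2)
  funext x
  have h0 : deriv (fun x => u x * deriv u x) x = 0 := by
    rw [funext hconst]; simp
  rw [(hd x).deriv, hval] at h0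
  have h1 : 0 < -(V x + μ) := by linarith [h x]
  by_contra hne
  have : 0 < u x ^ 2 := sq_pos_of_ne_zero hne
  nlinarith [sq_nonneg (deriv u x), mul_pos h1 this]

/-- A solution of `-u'' - V u = μ u` with vanishing Cauchy data is zero. -/
theorem eq_zero_of_cauchy_data_eq_zero {M : ℝ} (hM : ∀ x, |V x| ≤ M) {u : ℝ → ℝ}
    (hu : u ∈ solSet0 a V μ) (h0 : u 0 = 0) (h1 : deriv u 0 = 0) : u = 0 := by
  obtain ⟨hs, -, he⟩ := hu
  let v : ℝ → ℝ × ℝ → ℝ × ℝ := fun t p => (p.2, -(V t + μ) * p.1)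
  let K : NNReal := ⟨1 + M + |μ|, by linarith [abs_nonneg μ, (abs_nonneg _).trans (hM 0)]⟩
  have hM0 := (abs_nonneg _).trans (hM 0)
  have hv : ∀ t, LipschitzOnWith K (v t) Set.univ := fun t => by
    refine (LipschitzWith.of_dist_le_mul fun p q => ?_).lipschitzOnWith
    have h2 : |V t + μ| ≤ M + |μ| := (abs_add_le _ _).trans (by linarith [hM t])
    have hK : (K : ℝ) = 1 + M + |μ| := rfl
    rw [dist_eq_norm, dist_eq_norm, hK]
    have hp1 : |p.1 - q.1| ≤ ‖p - q‖ := norm_fst_le (p - q)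
    have hp2 : |p.2 - q.2| ≤ ‖p - q‖ := norm_snd_le (p - q)
    have hn := norm_nonneg (p - q)
    rw [Prod.norm_def (v t p - v t q)]
    refine max_le ?_ ?_
    · change |p.2 - q.2| ≤ _
      nlinarith [abs_nonneg μ]
    · change |-(V t + μ) * p.1 - -(V t + μ) * q.1| ≤ _
      rw [← mul_sub, abs_mul, abs_neg]
      calc |V t + μ| * |p.1 - q.1| ≤ (M + |μ|) * ‖p - q‖ := by gcongr
        _ ≤ _ := by nlinarith
  have hsol : (fun t => (u t, deriv u t)) = fun _ => (0 : ℝ × ℝ) := by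
    refine ODE_solution_unique_univ (t₀ := 0) hv (fun t => ⟨?_, trivial⟩)
      (fun t => ⟨?_, trivial⟩) (by simp [h0, h1])
    · have := (hs.differentiable (by simp) t).hasDerivAt.prodMk
        (differentiable_deriv_of_smooth hs t).hasDerivAt
      convert! this using 1
      exact Prod.ext rfl (by simp only [v]; linear_combination he t)
    · convert! hasDerivAt_const t (0 : ℝ × ℝ) using 1
      simp [v]
  exact funext fun t => congrArg Prod.fst (congrFun hsol t)

theorem finite_solSubmodule0 {M : ℝ} (hM : ∀ x, |V x| ≤ M) :
    Module.Finite ℝ (solSubmodule0 a V μ) := by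
  let Φ : solSubmodule0 a V μ →ₗ[ℝ] ℝ × ℝ :=
    { toFun := fun u => (u.1 0, deriv u.1 0)
      map_add' := fun u v => Prod.ext rfl (deriv_add (u.2.1.differentiable (by simp) 0)
        (v.2.1.differentiable (by simp) 0))
      map_smul' := fun c u => Prod.ext rfl (deriv_const_mul_field c) }
  refine Module.Finite.of_injective Φ ((injective_iff_map_eq_zero Φ).2 fun u hu => ?_)
  exact Subtype.ext (eq_zero_of_cauchy_data_eq_zero hM u.2 (congrArg Prod.fst hu)
    (congrArg Prod.snd hu))

end ODE

section Separation

variable {a : ℝ} {V : ℝ → ℝ} {lam : ℝ}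

theorem deriv_slice_left {f : ℝ × ℝ → ℝ} (hf : ContDiff ℝ (⊤ : ℕ∞) f) (y : ℝ) :
    (deriv fun s => f (s, y)) = fun s => fderiv ℝ f (s, y) (1, 0) := funext fun s =>
  ((hf.differentiable (by simp) (s, y)).hasFDerivAt.comp_hasDerivAt s
    ((hasDerivAt_id s).prodMk (hasDerivAt_const s y))).deriv

theorem integral_deriv_deriv_mul_cas {g : ℝ → ℝ} (hg : ContDiff ℝ (⊤ : ℕ∞) g)
    (hper : ∀ y, g (y + 2 * π) = g y) (k : ℤ) :
    ∫ y in (0 : ℝ)..2 * π, deriv (deriv g) y * cas k y =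
      -(k : ℝ) ^ 2 * ∫ y in (0 : ℝ)..2 * π, g y * cas k y := by
  have hg1 := (contDiff_infty_iff_deriv.1 hg).2
  have hg2 := (contDiff_infty_iff_deriv.1 hg1).2
  have hc := (contDiff_cas k).continuous
  have hc' := (contDiff_cas (-k)).continuous
  have hd : ∀ y, HasDerivAt (fun y => deriv g y * cas k y - g y * (k * cas (-k) y))
      (deriv (deriv g) y * cas k y + (k : ℝ) ^ 2 * (g y * cas k y)) y := fun y => by
    have h1 := (hg1.differentiable (by simp) y).hasDerivAt.mul (hasDerivAt_cas k y)
    have h2 := (hg.differentiable (by simp) y).hasDerivAt.mul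
      ((hasDerivAt_cas (-k) y).const_mul (k : ℝ))
    convert! h1.sub h2 using 1
    rw [neg_neg]; push_cast; ring
  have hi1 : IntervalIntegrable (fun y => deriv (deriv g) y * cas k y) volume 0 (2 * π) :=
    (hg2.continuous.mul hc).intervalIntegrable _ _
  have hi2 : IntervalIntegrable (fun y => (k : ℝ) ^ 2 * (g y * cas k y)) volume 0 (2 * π) :=
    (continuous_const.mul (hg.continuous.mul hc)).intervalIntegrable _ _
  have hftc := intervalIntegral.integral_eq_sub_of_hasDerivAt (a := 0) (b := 2 * π)
    (fun y _ => hd y) (hi1.add hi2)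
  rw [intervalIntegral.integral_add hi1 hi2, intervalIntegral.integral_const_mul] at hftc
  have e1 := hper 0
  have e2 : deriv g (0 + 2 * π) = deriv g 0 := by
    rw [← deriv_comp_add_const]; simp only [hper]
  have e3 := cas_periodic k 0
  have e4 := cas_periodic (-k) 0
  rw [zero_add] at e1 e2 e3 e4
  rw [e1, e2, e3, e4, sub_self] at hftc
  linarith

theorem casCoeff_mem (k : ℤ) {f : ℝ × ℝ → ℝ} (hf : f ∈ solSet a V lam) :
    (fun x => ∫ y in (0 : ℝ)..2 * π, f (x, y) * cas k y) ∈
      solSet0 a V (lam - (k : ℝ) ^ 2) := by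
  obtain ⟨hs, hp, hq, he⟩ := hf
  have hsmul : ∀ {g : ℝ × ℝ → ℝ}, ContDiff ℝ (⊤ : ℕ∞) g →
      ContDiff ℝ (⊤ : ℕ∞) fun p : ℝ × ℝ => g p * cas k p.2 := fun hg =>
    hg.mul ((contDiff_cas k).comp contDiff_snd)
  have hderiv : ∀ {g : ℝ × ℝ → ℝ}, ContDiff ℝ (⊤ : ℕ∞) g →
      (deriv fun x => ∫ y in (0 : ℝ)..2 * π, g (x, y) * cas k y) =
        fun x => ∫ y in (0 : ℝ)..2 * π, fderiv ℝ g (x, y) (1, 0) * cas k y := by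
    intro g hg
    funext x
    rw [(hasDerivAt_intervalIntegral_of_contDiff ((hsmul hg).of_le (by simp)) 0 (2 * π) x).deriv]
    refine intervalIntegral.integral_congr fun y _ => ?_
    have h1 := congrFun (deriv_slice_left (hsmul hg) y) x
    have h2 := congrFun (deriv_slice_left hg y) x
    simp only at h1 h2 ⊢
    rw [← h1, ← h2, deriv_mul_const ((contDiff_slice_left hg y).differentiable (by simp) x)]
  refine ⟨contDiff_intervalIntegral (hsmul hs) _ _, fun x => by simp only [hp], fun x => ?_⟩
  have hs1 := contDiff_fderiv_apply_const hs (1, 0)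
  rw [hderiv hs, hderiv hs1]
  have hyy := integral_deriv_deriv_mul_cas (contDiff_slice_right hs x) (hq x) k
  have hc := (contDiff_cas k).continuous
  have hgx := contDiff_slice_right hs x
  have hgyy := (contDiff_infty_iff_deriv.1 (contDiff_infty_iff_deriv.1 hgx).2).2
  have hxx : ∀ y, fderiv ℝ (fun p => fderiv ℝ f p (1, 0)) (x, y) (1, 0) * cas k y =
      -(deriv (deriv fun t => f (x, t)) y * cas k y)
        + -(V x + lam) * (f (x, y) * cas k y) := fun y => by
    have h := he x y
    rw [deriv_slice_left hs, congrFun (deriv_slice_left hs1 y) x] at h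
    linear_combination -cas k y * h
  simp_rw [hxx]
  have hcyy := hgyy.continuous
  have hcx := hgx.continuous
  rw [intervalIntegral.integral_add (Continuous.intervalIntegrable (by fun_prop) _ _)
    (Continuous.intervalIntegrable (by fun_prop) _ _),
    intervalIntegral.integral_neg, intervalIntegral.integral_const_mul, hyy]
  ring

theorem mul_cas_mem (k : ℤ) {u : ℝ → ℝ} (hu : u ∈ solSet0 a V (lam - (k : ℝ) ^ 2)) :
    (fun p : ℝ × ℝ => u p.1 * cas k p.2) ∈ solSet a V lam := by
  obtain ⟨hs, hp, he⟩ := hu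
  refine ⟨(hs.comp contDiff_fst).mul ((contDiff_cas k).comp contDiff_snd),
    fun x y => by simp only [hp], fun x y => by simp only [cas_periodic], fun x y => ?_⟩
  have h1 := deriv_deriv_const_mul (cas k y) u x
  have h2 := deriv_deriv_const_mul (u x) (cas k) y
  rw [deriv_deriv_cas] at h2
  simp only [mul_comm (cas k y)] at h1
  simp only [h1, h2]
  linear_combination cas k y * he x

variable (a V lam)

/-- The `k`-th `cas`-coefficient of a solution on the torus. -/
noncomputable def casCoeff (k : ℤ) :
    solSubmodule a V lam →ₗ[ℝ] solSubmodule0 a V (lam - (k : ℝ) ^ 2) where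
  toFun f := ⟨fun x => ∫ y in (0 : ℝ)..2 * π, f.1 (x, y) * cas k y, casCoeff_mem k f.2⟩
  map_add' f g := Subtype.ext <| funext fun x => by
    have hc := (contDiff_cas k).continuous
    have hf := (contDiff_slice_right f.2.1 x).continuous
    have hg := (contDiff_slice_right g.2.1 x).continuous
    change (∫ y in (0 : ℝ)..2 * π, (f.1 (x, y) + g.1 (x, y)) * cas k y) = _ + _
    simp_rw [add_mul]
    exact intervalIntegral.integral_add ((hf.mul hc).intervalIntegrable _ _)
      ((hg.mul hc).intervalIntegrable _ _)
  map_smul' c f := Subtype.ext <| funext fun x => by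
    change (∫ y in (0 : ℝ)..2 * π, (c * f.1 (x, y)) * cas k y) = c * _
    simp_rw [mul_assoc]
    exact intervalIntegral.integral_const_mul _ _

/-- The solution `u(x) cas(k y)` on the torus attached to a solution `u` on the circle. -/
noncomputable def mulCas (k : ℤ) :
    solSubmodule0 a V (lam - (k : ℝ) ^ 2) →ₗ[ℝ] solSubmodule a V lam where
  toFun u := ⟨fun p => u.1 p.1 * cas k p.2, mul_cas_mem k u.2⟩
  map_add' _ _ := Subtype.ext <| funext fun _ => add_mul _ _ _
  map_smul' _ _ := Subtype.ext <| funext fun _ => mul_assoc _ _ _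

theorem casCoeff_mulCas_self (k : ℤ) (u : solSubmodule0 a V (lam - (k : ℝ) ^ 2)) :
    casCoeff a V lam k (mulCas a V lam k u) = (2 * π) • u := by
  refine Subtype.ext <| funext fun x => ?_
  change (∫ y in (0 : ℝ)..2 * π, (u.1 x * cas k y) * cas k y) = 2 * π * u.1 x
  simp_rw [mul_assoc]
  rw [intervalIntegral.integral_const_mul, integral_cas_mul_cas, if_pos rfl]
  ring

theorem casCoeff_mulCas_of_ne {k l : ℤ} (h : k ≠ l) (u : solSubmodule0 a V (lam - (k : ℝ) ^ 2)) :
    casCoeff a V lam l (mulCas a V lam k u) = 0 := by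
  refine Subtype.ext <| funext fun x => ?_
  change (∫ y in (0 : ℝ)..2 * π, (u.1 x * cas k y) * cas l y) = 0
  simp_rw [mul_assoc]
  rw [intervalIntegral.integral_const_mul, integral_cas_mul_cas, if_neg h, mul_zero]

/-- If only the modes in `S` carry solutions, the torus eigenspace has dimension the sum of
the dimensions of the spaces of the modes in `S`. -/
theorem finrank_solSubmodule_eq_sum (S : Finset ℤ)
    (hfin : ∀ k : ℤ, Module.Finite ℝ (solSubmodule0 a V (lam - (k : ℝ) ^ 2)))
    (hS : ∀ k : ℤ, k ∉ S → ∀ u ∈ solSet0 a V (lam - (k : ℝ) ^ 2), u = 0) :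
    Module.finrank ℝ (solSubmodule a V lam) =
      ∑ k ∈ S, Module.finrank ℝ (solSubmodule0 a V (lam - (k : ℝ) ^ 2)) := by
  let Ψ : solSubmodule a V lam →ₗ[ℝ] Π k : S, solSubmodule0 a V (lam - ((k : ℤ) : ℝ) ^ 2) :=
    LinearMap.pi fun k => casCoeff a V lam k
  let Φ : (Π k : S, solSubmodule0 a V (lam - ((k : ℤ) : ℝ) ^ 2)) →ₗ[ℝ] solSubmodule a V lam :=
    ∑ k : S, mulCas a V lam k ∘ₗ LinearMap.proj k
  have hΨ : Function.Injective Ψ := by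
    refine (injective_iff_map_eq_zero Ψ).2 fun f hf => Subtype.ext <| funext fun p => ?_
    refine eq_zero_of_integral_mul_cas_eq_zero (g := fun y => f.1 (p.1, y))
      (contDiff_slice_right f.2.1 p.1).continuous (f.2.2.2.1 p.1) (fun k => ?_) p.2
    by_cases hk : k ∈ S
    · exact congrFun (congrArg Subtype.val (congrFun hf ⟨k, hk⟩)) p.1
    · exact congrFun (hS k hk _ (casCoeff a V lam k f).2) p.1
  have hΦ : Function.Injective Φ := by
    refine (injective_iff_map_eq_zero Φ).2 fun u hu => funext fun l => ?_
    have h : casCoeff a V lam l (Φ u) = (2 * π) • u l := by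
      simp only [Φ, LinearMap.sum_apply, LinearMap.comp_apply, LinearMap.proj_apply, map_sum]
      rw [Finset.sum_eq_single l, casCoeff_mulCas_self]
      · exact fun k _ hkl => casCoeff_mulCas_of_ne a V lam (fun h => hkl (Subtype.ext h)) _
      · simp
    rw [hu, map_zero] at h
    exact (smul_eq_zero.1 h.symm).resolve_left two_pi_pos.ne'
  have : Module.Finite ℝ (solSubmodule a V lam) := Module.Finite.of_injective Ψ hΨ
  rw [le_antisymm (LinearMap.finrank_le_finrank_of_injective hΨ)
    (LinearMap.finrank_le_finrank_of_injective hΦ), Module.finrank_pi_fintype]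
  exact Finset.sum_coe_sort S
    fun k => Module.finrank ℝ (solSubmodule0 a V (lam - (k : ℝ) ^ 2))

end Separation

theorem sum_Icc_neg_sq (g : ℝ → ℕ) (N : ℕ) :
    ∑ k ∈ Finset.Icc (-N : ℤ) N, g ((k : ℝ) ^ 2) =
      g 0 + 2 * ∑ n ∈ Finset.Icc 1 N, g ((n : ℝ) ^ 2) := by
  induction N with
  | zero => simp
  | succ N ih =>
    rw [Nat.cast_add, Nat.cast_one, Finset.Icc_succ_succ, Finset.sum_union (by simp),
      Finset.sum_pair (by lia), ih, Finset.sum_Icc_succ_top (by lia)]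
    push_cast
    rw [neg_sq]
    ring

/-- For every `lam`: (i) `E₀(lam - n²) = {0}` for all sufficiently large `n`, and
(ii) `dim E(lam) = dim E₀(lam) + 2 ⬝ Σ_{n ≥ 1} dim E₀(lam - n²)`, the sum having only
finitely many nonzero terms. -/
theorem torus_eigenspace_dimension (a : ℝ) (ha : 0 < a) (V : ℝ → ℝ)
    (hV : AnalyticOnNhd ℝ V Set.univ) (hVper : ∀ x : ℝ, V (x + a) = V x) (lam : ℝ) :
    ∃ N : ℕ, (∀ n : ℕ, N ≤ n → ∀ u ∈ solSet0 a V (lam - (n : ℝ) ^ 2), u = 0) ∧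
      dimE a V lam =
        dimE0 a V lam + 2 * ∑ n ∈ Finset.Icc 1 N, dimE0 a V (lam - (n : ℝ) ^ 2) := by
  obtain ⟨M, hM⟩ := exists_abs_le_of_periodic ha (continuousOn_univ.1 hV.continuousOn) hVper
  obtain ⟨N, hN⟩ := exists_nat_gt (M + |lam|)
  have hM0 := (abs_nonneg _).trans (hM 0)
  have hvanish : ∀ t : ℝ, (N : ℝ) ≤ t → ∀ u ∈ solSet0 a V (lam - t ^ 2), u = 0 := by
    intro t ht u hu
    have hN1 : (1 : ℝ) ≤ N := by
      have : (0 : ℝ) < N := by linarith [abs_nonneg lam]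
      exact_mod_cast this
    refine eq_zero_of_add_neg ha (fun x => ?_) hu
    nlinarith [le_abs_self (V x), hM x, le_abs_self lam]
  refine ⟨N, fun n hn => hvanish n (by exact_mod_cast hn), ?_⟩
  rw [dimE_eq, finrank_solSubmodule_eq_sum a V lam (Finset.Icc (-N : ℤ) N)
    (fun k => finite_solSubmodule0 hM)]
  · rw [sum_Icc_neg_sq fun t => Module.finrank ℝ (solSubmodule0 a V (lam - t))]
    simp only [dimE0_eq]
    rw [sub_zero]
  · intro k hk u hu
    refine hvanish |(k : ℝ)| ?_ u (by rwa [sq_abs])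
    rw [Finset.mem_Icc, ← abs_le, not_le] at hk
    exact_mod_cast hk.le
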